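/- Let R be a polynomial with real coefficients of degree N ≥ 2 such that R(0) = 0, c := R'(0) > 1, and there exists a > 0 with the property that every complex number z with R(z) ∈ [0,a] satisfies z ∈ [0,a]. Fix z₀ ∈ [0,a]. Then there exists a nondecreasing unbounded sequence (λ_j)_{j≥1} of positive real numbers such that for every s with Re(s) > d_R := 2·log N / log c, the limit ζ_{z₀,R}(s) := lim_{n→∞} Σ_{z ∈ R^{-n}{z₀}, z ≠ 0} (cⁿ z)^{-s/2} exists and equals the convergent Dirichlet series Σ_{j=1}^∞ λ_j^{-s/2}. -/

import Mathlib

open Polynomial Filter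

/-- The `n`-fold composition `R^{∘n}` of a polynomial, with `R^{∘0} = X`. -/
noncomputable def polyIter (R : Polynomial ℝ) : ℕ → Polynomial ℝ
  | 0 => Polynomial.X
  | n + 1 => R.comp (polyIter R n)

/-- The multiset `R^{-n}{z₀}` of complex roots (with multiplicity) of `R^{∘n}(z) - z₀`. -/
noncomputable def preimageRoots (R : Polynomial ℝ) (z₀ : ℝ) (n : ℕ) : Multiset ℂ :=
  ((polyIter R n - Polynomial.C z₀).map (algebraMap ℝ ℂ)).roots

/-- The partial sum `Σ_{z ∈ R^{-n}{z₀}, z ≠ 0} (cⁿ z)^{-s/2}`. -/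
noncomputable def zetaPartial (R : Polynomial ℝ) (c z₀ : ℝ) (n : ℕ) (s : ℂ) : ℂ :=
  ((preimageRoots R z₀ n).map
    (fun z => if z = 0 then 0 else ((c : ℂ) ^ n * z) ^ (-s / 2))).sum

/-- Membership of a complex number in the real interval `[0, a]`. -/
def memIcc (a : ℝ) (z : ℂ) : Prop := z.im = 0 ∧ z.re ∈ Set.Icc 0 a

theorem exists_equiv_monotone_of_tendsto_atTop {f : ℕ → ℝ} (hf : Tendsto f atTop atTop) :
    ∃ e : ℕ ≃ ℕ, Monotone (f ∘ e) := by
  let g : ℕ → ℝ ×ₗ ℕ := fun j => toLex (f j, j)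
  have hg : Function.Injective g := fun i j h => by
    have := congrArg (fun p => (ofLex p).2) h
    simpa [g] using this
  have hle : ∀ i j, g i ≤ g j → f i ≤ f j := fun i j h => by
    rcases Prod.Lex.le_iff.1 h with h | h
    · exact h.le
    · exact h.1.le
  have hfin : ∀ j, {i | f i ≤ f j}.Finite := fun j => by
    have h := (hf.eventually_gt_atTop (f j))
    rw [← Nat.cofinite_eq_atTop, eventually_cofinite] at h
    simpa using h
  let α := Set.range g
  let : LocallyFiniteOrder α := LocallyFiniteOrder.ofFiniteIcc fun x y => by
    obtain ⟨_, j, rfl⟩ := y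
    refine ((hfin j).image fun i => (⟨g i, i, rfl⟩ : α)).subset ?_
    rintro ⟨_, i, rfl⟩ h
    exact ⟨i, hle i j h.2, rfl⟩
  obtain ⟨m, hm⟩ : ∃ m, ∀ i, g m ≤ g i := by
    obtain ⟨m, hm, hmin⟩ := (hfin 0).exists_minimalFor g _ ⟨0, le_refl (f 0)⟩
    refine ⟨m, fun i => ?_⟩
    by_contra! h
    have := hmin (show f i ≤ f 0 from (hle _ _ h.le).trans hm) h.le
    exact absurd h (not_lt.2 this)
  let : OrderBot α := { bot := ⟨g m, m, rfl⟩, bot_le := by rintro ⟨_, i, rfl⟩; exact hm i }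
  have : Infinite α := Set.infinite_coe_iff.2 (Set.infinite_range_of_injective hg)
  have : NoMaxOrder α := ⟨by
    intro x
    by_contra! h
    have : (Set.univ : Set α) ⊆ Set.Icc ⊥ x := fun y _ => ⟨bot_le, h y⟩
    exact Set.infinite_univ ((Set.finite_Icc ⊥ x).subset this)⟩
  let := LinearLocallyFiniteOrder.succOrder α
  let := LinearLocallyFiniteOrder.predOrder α
  let e : α ≃o ℕ := orderIsoNatOfLinearSuccPredArch
  refine ⟨e.symm.toEquiv.trans (Equiv.ofInjective g hg).symm, fun i j hij => ?_⟩
  refine hle _ _ ?_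
  have h : ∀ i, g ((e.symm.toEquiv.trans (Equiv.ofInjective g hg).symm) i) = e.symm i := fun i =>
    Equiv.apply_ofInjective_symm hg (e.symm i)
  rw [h, h]
  exact e.symm.monotone hij

theorem prod_range_mul {M : Type*} [CommMonoid M] (f : ℕ → ℕ → M) (m n : ℕ) :
    ∏ k ∈ Finset.range (m * n), f (k % m) (k / m) =
      ∏ j ∈ Finset.range m, ∏ i ∈ Finset.range n, f j i := by
  rcases m.eq_zero_or_pos with rfl | hm
  · simp
  induction n with
  | zero => simp
  | succ n ih =>
    rw [mul_add, mul_one, Finset.prod_range_add, ih]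
    simp_rw [Finset.prod_range_succ, Finset.prod_mul_distrib]
    congr 1
    refine Finset.prod_congr rfl fun j hj => ?_
    rw [Finset.mem_range] at hj
    rw [Nat.mul_add_mod, Nat.mod_eq_of_lt hj, Nat.mul_add_div hm, Nat.div_eq_of_lt hj, add_zero]

/-- The first `N` values of `r` are the roots of `R - w`, with multiplicity; they lie in `[0, a]`
and `r 0` is the least. -/
structure IsRootList (R : ℝ[X]) (N : ℕ) (a w : ℝ) (r : ℕ → ℝ) : Prop where
  mem : ∀ i < N, r i ∈ Set.Icc 0 a
  le : ∀ i < N, r 0 ≤ r i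
  eq : R - C w = C R.leadingCoeff * ∏ i ∈ Finset.range N, (X - C (r i))

theorem exists_isRootList {R : ℝ[X]} {N : ℕ} (hN : R.natDegree = N) (hN2 : 2 ≤ N) {a : ℝ}
    (hinv : ∀ z : ℂ, memIcc a (aeval z R) → memIcc a z) {w : ℝ} (hw : w ∈ Set.Icc 0 a) :
    ∃ r, IsRootList R N a w r := by
  have hdeg : (C w).degree < R.degree := by
    refine degree_C_le.trans_lt (natDegree_pos_iff_degree_pos.1 (by omega))
  set P : ℂ[X] := (R - C w).map (algebraMap ℝ ℂ) with hP
  have hPdeg : P.natDegree = N := by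
    rw [hP, natDegree_map, natDegree_sub_eq_left_of_natDegree_lt (by simp; omega), hN]
  have hlead : P.leadingCoeff = (R.leadingCoeff : ℂ) := by
    rw [hP, leadingCoeff_map, leadingCoeff_sub_of_degree_lt hdeg]
    rfl
  have hroot : ∀ z ∈ P.roots, memIcc a z := fun z hz => by
    refine hinv z ?_
    have h := (mem_roots'.1 hz).2
    rw [hP, IsRoot, eval_map_algebraMap, map_sub, aeval_C, sub_eq_zero] at h
    rw [h]
    exact ⟨by simp, by simpa using hw⟩
  let l : List ℝ := (P.roots.map Complex.re).sort (· ≤ ·)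
  have hl : (l : Multiset ℝ) = P.roots.map Complex.re := Multiset.sort_eq _ _
  have hlen : l.length = N := by
    rw [← Multiset.coe_card, hl, Multiset.card_map, ← hPdeg]
    exact (IsAlgClosed.splits P).natDegree_eq_card_roots.symm
  have hmem : ∀ i (h : i < l.length), l[i] ∈ Set.Icc 0 a := fun i h => by
    have : l[i] ∈ P.roots.map Complex.re := by
      rw [← hl]
      exact Multiset.mem_coe.2 (List.getElem_mem h)
    obtain ⟨z, hz, hz'⟩ := Multiset.mem_map.1 this
    rw [← hz']
    exact (hroot z hz).2
  refine ⟨fun i => l.getD i 0, fun i hi => ?_, fun i hi => ?_, ?_⟩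
  · have hi' : i < l.length := by omega
    rw [List.getD_eq_getElem _ _ hi']
    exact hmem i hi'
  · have hi' : i < l.length := by omega
    have h0 : 0 < l.length := by omega
    rw [List.getD_eq_getElem _ _ hi', List.getD_eq_getElem _ _ h0]
    exact (Multiset.pairwise_sort (P.roots.map Complex.re) (· ≤ ·)).sortedLE.monotone_get
      (show (⟨0, h0⟩ : Fin l.length) ≤ ⟨i, hi'⟩ from Nat.zero_le _)
  · apply map_injective (algebraMap ℝ ℂ) (algebraMap ℝ ℂ).injective
    have h1 : P = C P.leadingCoeff * (P.roots.map (X - C ·)).prod :=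
      (IsAlgClosed.splits P).eq_prod_roots
    have h2 : P.roots = (l : Multiset ℝ).map (fun x : ℝ => (x : ℂ)) := by
      rw [hl, Multiset.map_map]
      refine (Multiset.map_id' P.roots).symm.trans (Multiset.map_congr rfl fun z hz => ?_)
      exact Complex.ext (by simp) (by simpa using (hroot z hz).1)
    change P = _
    rw [h1, hlead, h2, Multiset.map_map, Multiset.map_coe, Multiset.prod_coe]
    rw [Polynomial.map_mul, map_C, Polynomial.map_prod]
    congr 1
    rw [← hlen, Finset.prod_range, ← List.prod_ofFn]
    congr 1
    refine List.ext_getElem (by simp) fun i h _ => ?_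
    simp

namespace IsRootList

variable {R : ℝ[X]} {N : ℕ} {a b w : ℝ} {r : ℕ → ℝ}

theorem eval_sub (h : IsRootList R N a w r) (x : ℝ) :
    R.eval x - w = R.leadingCoeff * ∏ i ∈ Finset.range N, (x - r i) := by
  have := congrArg (eval x) h.eq
  simpa [eval_prod] using this

theorem eval_eq (h : IsRootList R N a w r) {i : ℕ} (hi : i < N) : R.eval (r i) = w := by
  rw [← sub_eq_zero, h.eval_sub, Finset.prod_eq_zero (Finset.mem_range.2 hi) (sub_self _),
    mul_zero]

theorem zero_le_of_eval_eq (h : IsRootList R N a w r) (hR : R ≠ 0) {y : ℝ}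
    (hy : R.eval y = w) : r 0 ≤ y := by
  have h0 := h.eval_sub y
  rw [hy, sub_self, eq_comm, mul_eq_zero, Finset.prod_eq_zero_iff] at h0
  obtain ⟨i, hi, hyi⟩ := h0.resolve_left (leadingCoeff_ne_zero.2 hR)
  rw [sub_eq_zero.1 hyi]
  exact h.le i (Finset.mem_range.1 hi)

theorem lt_of_ne_zero (h : IsRootList R N a w r)
    (hR' : ∀ x ∈ Set.Icc 0 b, 0 < R.derivative.eval x) {i : ℕ} (hi : i < N) (hi0 : i ≠ 0) :
    b < r i := by
  by_contra! hb
  have hN : 0 < N := by omega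
  have hr0 := (h.mem 0 hN).1
  rcases (h.le i hi).eq_or_lt with heq | hlt
  · have hd := congrArg (fun p => p.derivative.eval (r 0)) h.eq
    rw [← Finset.mul_prod_erase _ _ (Finset.mem_range.2 hN),
      ← Finset.mul_prod_erase _ _ (Finset.mem_erase.2 ⟨hi0, Finset.mem_range.2 hi⟩), ← heq] at hd
    simp [derivative_mul] at hd
    exact (hR' (r 0) ⟨hr0, heq.trans_le hb⟩).ne' hd
  · obtain ⟨x, hx, hx0⟩ := exists_deriv_eq_zero hlt R.continuous.continuousOn
      ((h.eval_eq hN).trans (h.eval_eq hi).symm)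
    rw [Polynomial.deriv] at hx0
    exact (hR' x ⟨hr0.trans hx.1.le, hx.2.le.trans hb⟩).ne' hx0

end IsRootList

/-- On `[0, b]` the fixed point `0` of `R` is repelling with multiplier `c`, and `x ± M * x ^ 2` are
respectively super- and sub-solutions of the Schröder equation `h (R x) = c * h x`. -/
structure RepellingBounds (R : ℝ[X]) (c b M L θ : ℝ) : Prop where
  pos : 0 < b
  nonneg : 0 ≤ M
  mul_le : M * b ≤ 1 / 2
  L_pos : 0 < L
  one_lt : 1 < θ
  mul_le_eval : ∀ u ∈ Set.Icc 0 b, θ * u ≤ R.eval u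
  eval_le_mul : ∀ u ∈ Set.Icc 0 b, R.eval u ≤ L * u
  sub_le : ∀ u ∈ Set.Icc 0 b, R.eval u - M * R.eval u ^ 2 ≤ c * (u - M * u ^ 2)
  le_add : ∀ u ∈ Set.Icc 0 b, c * (u + M * u ^ 2) ≤ R.eval u + M * R.eval u ^ 2
  derivative_pos : ∀ u ∈ Set.Icc 0 b, 0 < R.derivative.eval u

theorem exists_repellingBounds {R : ℝ[X]} {c : ℝ} (hR0 : R.eval 0 = 0)
    (hc : R.derivative.eval 0 = c) (hc1 : 1 < c) :
    ∃ b M L θ, RepellingBounds R c b M L θ := by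
  obtain ⟨Q, hQ⟩ : ∃ Q : ℝ[X], R = C c * X + X ^ 2 * Q := by
    have h0 : R.coeff 0 = 0 := by rw [coeff_zero_eq_eval_zero, hR0]
    have h1 : R.coeff 1 = c := by
      rw [← hc, ← coeff_zero_eq_eval_zero, coeff_derivative]; simp
    obtain ⟨Q, hQ⟩ : X ^ 2 ∣ R - C c * X := by
      rw [X_pow_dvd_iff]
      intro d hd
      interval_cases d
      · simp [h0]
      · simp [h1]
    exact ⟨Q, by rw [← hQ]; ring⟩
  obtain ⟨K, hK⟩ := (isCompact_Icc (a := (0 : ℝ)) (b := 1)).exists_bound_of_continuousOn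
    Q.continuous.continuousOn
  have hK0 : 0 ≤ K := (norm_nonneg _).trans (hK 0 (by simp))
  obtain ⟨δ, hδ, hδ'⟩ : ∃ δ > 0, ∀ u ∈ Set.Icc 0 δ, 0 < R.derivative.eval u := by
    have : ∀ᶠ u in nhds (0 : ℝ), 0 < R.derivative.eval u :=
      R.derivative.continuous.continuousAt.eventually_const_lt (by simp only [hc]; linarith)
    obtain ⟨ε, hε, h⟩ := Metric.eventually_nhds_iff.1 this
    refine ⟨ε / 2, by linarith, fun u hu => h ?_⟩
    rw [Real.dist_eq, sub_zero, abs_of_nonneg hu.1]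
    linarith [hu.2]
  obtain ⟨θ, hθ1, hθc⟩ : ∃ θ, √c < θ ∧ θ < c :=
    exists_between (Real.sqrt_lt' (by linarith) |>.2 (by nlinarith))
  have hs : 1 < √c := Real.lt_sqrt zero_le_one |>.2 (by linarith)
  have hθ : 1 < θ := hs.trans hθ1
  have hθ2 : c < θ ^ 2 := (Real.sqrt_lt' (by linarith)).1 hθ1
  obtain ⟨M, hM0, hM⟩ : ∃ M, 0 ≤ M ∧ M * (θ ^ 2 - c) = K :=
    ⟨K / (θ ^ 2 - c), div_nonneg hK0 (by linarith), div_mul_cancel₀ _ (by linarith)⟩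
  obtain ⟨b, hb, hb1, hbδ, hbK, hbM⟩ :
      ∃ b, 0 < b ∧ b ≤ 1 ∧ b ≤ δ ∧ K * b ≤ c - θ ∧ M * b ≤ 1 / 2 := by
    refine ⟨min (min 1 δ) (min ((c - θ) / (K + 1)) (1 / 2 / (M + 1))), ?_, ?_, ?_, ?_, ?_⟩
    · have : 0 < c - θ := by linarith
      positivity
    · exact (min_le_left _ _).trans (min_le_left _ _)
    · exact (min_le_left _ _).trans (min_le_right _ _)
    · have := (min_le_right (min 1 δ) _).trans (min_le_left ((c - θ) / (K + 1)) (1 / 2 / (M + 1)))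
      refine (mul_le_mul_of_nonneg_left this hK0).trans ?_
      rw [mul_div_assoc', div_le_iff₀ (by linarith)]
      nlinarith
    · have := (min_le_right (min 1 δ) _).trans (min_le_right ((c - θ) / (K + 1)) (1 / 2 / (M + 1)))
      refine (mul_le_mul_of_nonneg_left this hM0).trans ?_
      rw [mul_div_assoc', div_le_iff₀ (by linarith)]
      nlinarith
  have hev : ∀ u ∈ Set.Icc 0 b, c * u - K * u ^ 2 ≤ R.eval u ∧ R.eval u ≤ c * u + K * u ^ 2 := by
    intro u hu
    have h := abs_le.1 (hK u ⟨hu.1, hu.2.trans hb1⟩)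
    have : R.eval u = c * u + u ^ 2 * Q.eval u := by
      conv_lhs => rw [hQ]
      simp
    rw [this]
    constructor <;> nlinarith [sq_nonneg u]
  have hlow : ∀ u ∈ Set.Icc 0 b, θ * u ≤ R.eval u := fun u hu => by
    refine le_trans ?_ (hev u hu).1
    have : K * u ≤ c - θ := (mul_le_mul_of_nonneg_left hu.2 hK0).trans hbK
    nlinarith [hu.1]
  have hsq : ∀ u ∈ Set.Icc 0 b, M * (θ ^ 2 * u ^ 2) ≤ M * R.eval u ^ 2 := fun u hu => by
    refine mul_le_mul_of_nonneg_left ?_ hM0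
    rw [← mul_pow]
    exact pow_le_pow_left₀ (mul_nonneg (by linarith) hu.1) (hlow u hu) 2
  have hMu : ∀ u, M * (θ ^ 2 * u ^ 2) = c * M * u ^ 2 + K * u ^ 2 := fun u => by
    rw [← hM]; ring
  refine ⟨b, M, c + K * b, θ, hb, hM0, hbM, by positivity, hθ, hlow, fun u hu => ?_,
    fun u hu => ?_, fun u hu => ?_, fun u hu => hδ' u ⟨hu.1, hu.2.trans hbδ⟩⟩
  · refine (hev u hu).2.trans ?_
    have := mul_le_mul_of_nonneg_left hu.2 (mul_nonneg hK0 hu.1)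
    nlinarith
  · have := hsq u hu
    rw [hMu] at this
    linarith [(hev u hu).2]
  · have := hsq u hu
    rw [hMu] at this
    linarith [(hev u hu).1]

theorem tendsto_pow_mul_of_backward_orbit {R : ℝ[X]} {c b M L θ : ℝ} (hc1 : 1 < c)
    (hB : RepellingBounds R c b M L θ) {y : ℕ → ℝ} (hy : ∀ k, y k ∈ Set.Icc 0 b) (hy0 : 0 < y 0)
    (hR : ∀ k, R.eval (y (k + 1)) = y k) :
    ∃ μ, 0 < μ ∧ Tendsto (fun k => c ^ k * y k) atTop (nhds μ) := by
  have hc0 : 0 < c := by linarith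
  have hθ0 : 0 < θ := by linarith [hB.one_lt]
  have hadd : Antitone fun k => c ^ k * (y k + M * y k ^ 2) := antitone_nat_of_succ_le fun k => by
    have := hB.le_add _ (hy (k + 1))
    rw [hR] at this
    rw [pow_succ c, mul_assoc]
    gcongr
  have hsub : Monotone fun k => c ^ k * (y k - M * y k ^ 2) := monotone_nat_of_le_succ fun k => by
    have := hB.sub_le _ (hy (k + 1))
    rw [hR] at this
    rw [pow_succ c, mul_assoc]
    gcongr
  have hyz : Tendsto y atTop (nhds 0) := by
    have hle : ∀ k, y k ≤ y 0 * (θ⁻¹) ^ k := fun k => by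
      induction k with
      | zero => simp
      | succ k ih =>
        have := hB.mul_le_eval _ (hy (k + 1))
        rw [hR] at this
        rw [pow_succ, ← mul_assoc, ← div_eq_mul_inv, le_div_iff₀ hθ0]
        linarith
    refine squeeze_zero (fun k => (hy k).1) hle ?_
    simpa using (tendsto_pow_atTop_nhds_zero_of_lt_one (inv_nonneg.2 hθ0.le)
      (inv_lt_one_of_one_lt₀ hB.one_lt)).const_mul (y 0)
  have hM : ∀ k, 0 ≤ M * y k ^ 2 := fun k => mul_nonneg hB.nonneg (sq_nonneg _)
  obtain ⟨μ, hμ⟩ : ∃ μ, Tendsto (fun k => c ^ k * (y k + M * y k ^ 2)) atTop (nhds μ) :=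
    ⟨_, tendsto_atTop_ciInf hadd ⟨0, by
      rintro _ ⟨k, rfl⟩
      exact mul_nonneg (by positivity) (add_nonneg (hy k).1 (hM k))⟩⟩
  have hden : Tendsto (fun k => 1 + M * y k) atTop (nhds 1) := by
    simpa using (hyz.const_mul M).const_add 1
  have hlim : Tendsto (fun k => c ^ k * y k) atTop (nhds μ) := by
    have := hμ.div hden one_ne_zero
    rw [div_one] at this
    refine this.congr fun k => ?_
    have : 0 ≤ M * y k := mul_nonneg hB.nonneg (hy k).1
    rw [Pi.div_apply, div_eq_iff (by linarith)]
    ring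
  refine ⟨μ, ?_, hlim⟩
  have h0 : 0 < y 0 - M * y 0 ^ 2 := by
    have := mul_le_mul_of_nonneg_left (hy 0).2 hB.nonneg
    nlinarith [hB.mul_le]
  refine h0.trans_le (ge_of_tendsto' hlim fun k => ?_)
  have := hsub (Nat.zero_le k)
  simp only [pow_zero, one_mul] at this
  refine this.trans ?_
  gcongr
  linarith [hM k]

theorem polyIter_succ (R : ℝ[X]) (n : ℕ) : polyIter R (n + 1) = (polyIter R n).comp R := by
  induction n with
  | zero => simp [polyIter]
  | succ n ih =>
    change R.comp (polyIter R (n + 1)) = (R.comp (polyIter R n)).comp R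
    rw [ih, comp_assoc]

/-- The `j`-th element, `j < N ^ n`, of the `n`-th preimage of `z₀`, where `r w` lists the preimages
of `w`; the base `N` digits of `j` record the branches chosen. -/
noncomputable def preimagePoint (r : ℝ → ℕ → ℝ) (N : ℕ) (z₀ : ℝ) : ℕ → ℕ → ℝ
  | 0, _ => z₀
  | n + 1, j => r (preimagePoint r N z₀ n (j % N ^ n)) (j / N ^ n)

section Tree

variable {R : ℝ[X]} {N : ℕ} {a b c M L θ z₀ : ℝ} {r : ℝ → ℕ → ℝ}

theorem preimagePoint_mem (hN : 0 < N) (hr : ∀ w ∈ Set.Icc 0 a, IsRootList R N a w (r w))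
    (hz₀ : z₀ ∈ Set.Icc 0 a) (n : ℕ) :
    ∀ j < N ^ n, preimagePoint r N z₀ n j ∈ Set.Icc 0 a := by
  induction n with
  | zero => exact fun _ _ => hz₀
  | succ n ih =>
    intro j hj
    refine (hr _ (ih _ (Nat.mod_lt _ (by positivity)))).mem _ ?_
    rw [Nat.div_lt_iff_lt_mul (by positivity), ← pow_succ']
    exact hj

theorem preimagePoint_succ_of_lt {n j : ℕ} (hj : j < N ^ n) :
    preimagePoint r N z₀ (n + 1) j = r (preimagePoint r N z₀ n j) 0 := by
  rw [preimagePoint, Nat.mod_eq_of_lt hj, Nat.div_eq_of_lt hj]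

theorem exists_polyIter_sub_eq_prod (hN : 0 < N) (hR : R ≠ 0)
    (hr : ∀ w ∈ Set.Icc 0 a, IsRootList R N a w (r w)) (hz₀ : z₀ ∈ Set.Icc 0 a) (n : ℕ) :
    ∃ l : ℝ, l ≠ 0 ∧ polyIter R n - C z₀ =
      C l * ∏ j ∈ Finset.range (N ^ n), (X - C (preimagePoint r N z₀ n j)) := by
  induction n with
  | zero => exact ⟨1, one_ne_zero, by simp [polyIter, preimagePoint]⟩
  | succ n ih =>
    obtain ⟨l, hl, h⟩ := ih
    refine ⟨l * R.leadingCoeff ^ N ^ n,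
      mul_ne_zero hl (pow_ne_zero _ (leadingCoeff_ne_zero.2 hR)), ?_⟩
    have h1 : polyIter R (n + 1) - C z₀ = (polyIter R n - C z₀).comp R := by
      rw [polyIter_succ, sub_comp, C_comp]
    rw [h1, h, mul_comp, C_comp, prod_comp, C_mul, mul_assoc]
    congr 1
    have h2 : ∀ j ∈ Finset.range (N ^ n), (X - C (preimagePoint r N z₀ n j)).comp R =
        C R.leadingCoeff *
          ∏ i ∈ Finset.range N, (X - C (r (preimagePoint r N z₀ n j) i)) := fun j hj => by
      rw [sub_comp, X_comp, C_comp]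
      exact (hr _ (preimagePoint_mem hN hr hz₀ n j (Finset.mem_range.1 hj))).eq
    rw [Finset.prod_congr rfl h2, Finset.prod_mul_distrib, Finset.prod_const, Finset.card_range,
      ← C_pow, pow_succ,
      ← prod_range_mul (fun j i => X - C (r (preimagePoint r N z₀ n j) i))]
    rfl

theorem preimageRoots_eq (hN : 0 < N) (hR : R ≠ 0)
    (hr : ∀ w ∈ Set.Icc 0 a, IsRootList R N a w (r w)) (hz₀ : z₀ ∈ Set.Icc 0 a) (n : ℕ) :
    preimageRoots R z₀ n =
      (Multiset.range (N ^ n)).map fun j => (preimagePoint r N z₀ n j : ℂ) := by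
  obtain ⟨l, hl, h⟩ := exists_polyIter_sub_eq_prod hN hR hr hz₀ n
  rw [preimageRoots, h, Polynomial.map_mul, map_C, Polynomial.map_prod,
    roots_C_mul _ (by simpa using hl)]
  simp only [Polynomial.map_sub, map_X, map_C]
  rw [← roots_multiset_prod_X_sub_C
    ((Multiset.range (N ^ n)).map fun j => (preimagePoint r N z₀ n j : ℂ)), Multiset.map_map]
  rfl

theorem mul_le_eval_of_le_root {e : ℝ} {ρ : ℕ → ℝ} (hN : 0 < N) (ha : 0 < a)
    (hR0 : R.eval 0 = 0) (hρ : IsRootList R N a a ρ) (he : ρ 0 = e) (he0 : 0 < e) :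
    ∀ x ∈ Set.Icc 0 e, a * x / e ≤ R.eval x := by
  intro x hx
  have h0 := hρ.eval_sub 0
  have h1 := hρ.eval_sub x
  obtain ⟨n, rfl⟩ : ∃ n, N = n + 1 := ⟨N - 1, by omega⟩
  have hle : |∏ i ∈ Finset.range n, (x - ρ (i + 1))| ≤ |∏ i ∈ Finset.range n, (0 - ρ (i + 1))| := by
    rw [Finset.abs_prod, Finset.abs_prod]
    refine Finset.prod_le_prod (fun _ _ => abs_nonneg _) fun i hi => ?_
    have hi' : i + 1 < n + 1 := by simpa using hi
    have h2 := hρ.le _ hi'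
    have h3 := hx.2
    have h4 := hx.1
    rw [abs_of_nonpos (by linarith), abs_of_nonpos (by linarith)]
    linarith
  rw [Finset.prod_range_succ', he] at h0 h1
  have h0' := congrArg abs h0
  have h1' := congrArg abs h1
  rw [hR0, abs_mul, abs_mul, zero_sub, abs_neg, abs_of_pos ha, zero_sub, abs_neg,
    abs_of_pos he0] at h0'
  rw [abs_mul, abs_mul, abs_of_nonpos (by linarith [hx.2] : x - e ≤ 0)] at h1'
  have h5 : |R.eval x - a| * e ≤ a * (e - x) := by
    rw [h1', h0']
    have : 0 ≤ |R.leadingCoeff| * (e - x) * e :=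
      mul_nonneg (mul_nonneg (abs_nonneg _) (by linarith [hx.2])) he0.le
    simp only [zero_sub] at hle ⊢
    nlinarith [mul_le_mul_of_nonneg_left hle this]
  rw [div_le_iff₀ he0]
  nlinarith [neg_abs_le (R.eval x - a)]

theorem exists_backward_orbit_le (hN2 : 2 ≤ N) (ha : 0 < a) (hR : R ≠ 0)
    (hR0 : R.eval 0 = 0) (hr : ∀ w ∈ Set.Icc 0 a, IsRootList R N a w (r w))
    (hB : RepellingBounds R c b M L θ) {y : ℕ → ℝ} (hy : ∀ k, y k ∈ Set.Icc 0 a)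
    (hys : ∀ k, y (k + 1) = r (y k) 0) : ∃ k, y k ≤ b := by
  by_contra! hb
  have hN : 0 < N := by omega
  have hra := hr a ⟨ha.le, le_rfl⟩
  set e := r a 0 with he
  have hea : e ∈ Set.Icc 0 a := hra.mem 0 hN
  have hRe : R.eval e = a := hra.eval_eq hN
  have he0 : 0 < e := hea.1.lt_of_ne fun h => by
    rw [← h, hR0] at hRe
    exact ha.ne hRe
  have hexp := mul_le_eval_of_le_root hN ha hR0 hra rfl he0
  have hlt : e < a := hea.2.lt_of_ne fun h => by
    have h0 := hr 0 ⟨le_rfl, ha.le⟩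
    have hpos : 0 < r 0 1 :=
      hB.pos.trans (h0.lt_of_ne_zero hB.derivative_pos (by omega) one_ne_zero)
    have := hexp (r 0 1) ⟨hpos.le, (h0.mem 1 (by omega)).2.trans h.ge⟩
    rw [h0.eval_eq (by omega)] at this
    have : 0 < a * r 0 1 / e := by positivity
    linarith
  have hself : ∀ x ∈ Set.Ioc 0 e, x < R.eval x := fun x hx => by
    refine lt_of_lt_of_le ?_ (hexp x ⟨hx.1.le, hx.2⟩)
    rw [lt_div_iff₀ he0]
    nlinarith [hx.1]
  have hRy : ∀ k, R.eval (y (k + 1)) = y k := fun k => by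
    rw [hys]
    exact (hr _ (hy k)).eval_eq hN
  have hye : ∀ k, y (k + 1) ≤ e := fun k => by
    obtain ⟨x, hx, hxy⟩ := intermediate_value_Icc he0.le R.continuous.continuousOn
      (show y k ∈ Set.Icc (R.eval 0) (R.eval e) by rw [hR0, hRe]; exact hy k)
    rw [hys]
    exact ((hr _ (hy k)).zero_le_of_eval_eq hR hxy).trans hx.2
  have hanti : Antitone fun k => y (k + 1) := antitone_nat_of_succ_le fun k => by
    have := hself (y (k + 2)) ⟨hB.pos.trans (hb _), hye _⟩
    rw [hRy] at this
    exact this.le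
  have hlim := tendsto_atTop_ciInf hanti ⟨0, by rintro _ ⟨k, rfl⟩; exact (hy _).1⟩
  set ℓ := ⨅ k, y (k + 1)
  have hl : b ≤ ℓ := ge_of_tendsto' hlim fun k => (hb _).le
  have hle : ℓ ≤ e := le_of_tendsto' hlim hye
  have h1 : Tendsto (fun k => y (k + 1)) atTop (nhds (R.eval ℓ)) := by
    refine ((R.continuous.tendsto ℓ).comp ((tendsto_add_atTop_iff_nat 1).2 hlim)).congr fun k => ?_
    exact hRy (k + 1)
  exact (hself ℓ ⟨hB.pos.trans_le hl, hle⟩).ne (tendsto_nhds_unique hlim h1)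

theorem exists_pos_tendsto_preimagePoint (hc1 : 1 < c) (hN2 : 2 ≤ N) (ha : 0 < a) (hR : R ≠ 0)
    (hR0 : R.eval 0 = 0) (hr : ∀ w ∈ Set.Icc 0 a, IsRootList R N a w (r w))
    (hB : RepellingBounds R c b M L θ) (hz₀ : z₀ ∈ Set.Icc 0 a) {n j : ℕ} (hj : j < N ^ n)
    (hnj : preimagePoint r N z₀ n j ≠ 0) :
    ∃ μ, 0 < μ ∧ Tendsto (fun m => c ^ m * preimagePoint r N z₀ m j) atTop (nhds μ) := by
  have hN : 0 < N := by omega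
  have hjk : ∀ k, j < N ^ (n + k) := fun k => hj.trans_le (Nat.pow_le_pow_right hN (by omega))
  set y : ℕ → ℝ := fun k => preimagePoint r N z₀ (n + k) j with hy
  have hya : ∀ k, y k ∈ Set.Icc 0 a := fun k => preimagePoint_mem hN hr hz₀ _ _ (hjk k)
  have hys : ∀ k, y (k + 1) = r (y k) 0 := fun k => preimagePoint_succ_of_lt (hjk k)
  have hRy : ∀ k, R.eval (y (k + 1)) = y k := fun k => by
    rw [hys]
    exact (hr _ (hya k)).eval_eq hN
  have hpos : ∀ k, 0 < y k := fun k => by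
    refine (hya k).1.lt_of_ne' ?_
    induction k with
    | zero => exact hnj
    | succ k ih => exact fun h => ih (by rw [← hRy, h, hR0])
  obtain ⟨m, hm⟩ := exists_backward_orbit_le hN2 ha hR hR0 hr hB hya hys
  have hle : ∀ k, y (m + k) ≤ b := fun k => by
    induction k with
    | zero => exact hm
    | succ k ih =>
      have hb := hB.mul_le_eval b ⟨hB.pos.le, le_rfl⟩
      have hb' : b ≤ R.eval b := by nlinarith [hB.one_lt, hB.pos]
      obtain ⟨x, hx, hxy⟩ := intermediate_value_Icc hB.pos.le R.continuous.continuousOn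
        (show y (m + k) ∈ Set.Icc (R.eval 0) (R.eval b) by
          rw [hR0]; exact ⟨(hya _).1, ih.trans hb'⟩)
      rw [← add_assoc, hys]
      exact ((hr _ (hya _)).zero_le_of_eval_eq hR hxy).trans hx.2
  obtain ⟨μ, hμ, hlim⟩ := tendsto_pow_mul_of_backward_orbit hc1 hB
    (y := fun k => y (m + k)) (fun k => ⟨(hya _).1, hle k⟩) (hpos _) fun k => hRy (m + k)
  refine ⟨c ^ (n + m) * μ, by positivity, (tendsto_add_atTop_iff_nat (n + m)).1 ?_⟩
  refine (hlim.const_mul (c ^ (n + m))).congr fun k => ?_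
  rw [add_comm k, pow_add c (n + m), mul_assoc, add_assoc n m k]

theorem preimagePoint_ne_zero (hN2 : 2 ≤ N) (hr : ∀ w ∈ Set.Icc 0 a, IsRootList R N a w (r w))
    (hB : RepellingBounds R c b M L θ) (hz₀ : z₀ ∈ Set.Icc 0 a) {j : ℕ} (hj : j ≠ 0) :
    ∃ n, j < N ^ n ∧ preimagePoint r N z₀ n j ≠ 0 := by
  have hN : 0 < N := by omega
  have hlt := Nat.lt_pow_succ_log_self (b := N) (by omega) j
  have hle := Nat.pow_log_le_self N hj
  refine ⟨Nat.log N j + 1, hlt, (hB.pos.trans ?_).ne'⟩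
  have hmem := preimagePoint_mem hN hr hz₀ (Nat.log N j) (j % N ^ Nat.log N j)
    (Nat.mod_lt _ (by positivity))
  refine (hr _ hmem).lt_of_ne_zero hB.derivative_pos ?_ (Nat.div_pos hle (by positivity)).ne'
  rw [Nat.div_lt_iff_lt_mul (by positivity), ← pow_succ']
  exact hlt

theorem exists_le_pow_mul_preimagePoint (hc1 : 1 < c) (hN : 0 < N)
    (hr : ∀ w ∈ Set.Icc 0 a, IsRootList R N a w (r w))
    (hB : RepellingBounds R c b M L θ) (hz₀ : z₀ ∈ Set.Icc 0 a) {q : ℝ} (hq : 0 ≤ q)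
    (hNq : (N : ℝ) ^ q = c) :
    ∃ κ > 0, ∀ n, ∀ j < N ^ n, preimagePoint r N z₀ n j ≠ 0 →
      κ * ((j : ℝ) + 1) ^ q ≤ c ^ n * preimagePoint r N z₀ n j := by
  have hc0 : 0 < c := by linarith
  obtain ⟨κ, hκ, hκb, hκL, hκz⟩ :
      ∃ κ > 0, κ ≤ b ∧ κ ≤ b / (2 * L) ∧ (z₀ ≠ 0 → κ ≤ z₀ / 2) := by
    have h1 := hB.pos
    have h2 : 0 < b / (2 * L) := div_pos h1 (mul_pos two_pos hB.L_pos)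
    rcases hz₀.1.eq_or_lt with h | h
    · exact ⟨min b (b / (2 * L)), lt_min h1 h2, min_le_left _ _, min_le_right _ _,
        fun h' => absurd h.symm h'⟩
    · exact ⟨min (min b (b / (2 * L))) (z₀ / 2), lt_min (lt_min h1 h2) (by linarith),
        (min_le_left _ _).trans (min_le_left _ _), (min_le_left _ _).trans (min_le_right _ _),
        fun _ => min_le_right _ _⟩
  have hpow : ∀ n j : ℕ, j < N ^ n → ((j : ℝ) + 1) ^ q ≤ c ^ n := fun n j hj => by
    have h : (j : ℝ) + 1 ≤ (N : ℝ) ^ n := by exact_mod_cast hj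
    rw [← hNq, ← Real.rpow_mul_natCast (by positivity), mul_comm, Real.rpow_natCast_mul (by positivity)]
    exact Real.rpow_le_rpow (by positivity) h hq
  have hhalf : ∀ u ∈ Set.Icc 0 b, u / 2 ≤ u - M * u ^ 2 := fun u hu => by
    have := mul_le_mul_of_nonneg_left hu.2 hB.nonneg
    nlinarith [hB.mul_le, hu.1]
  have hsmall : ∀ n, ∀ j < N ^ n, preimagePoint r N z₀ n j ≠ 0 → preimagePoint r N z₀ n j ≤ b →
      κ * ((j : ℝ) + 1) ^ q ≤
        c ^ n * (preimagePoint r N z₀ n j - M * preimagePoint r N z₀ n j ^ 2) := by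
    intro n
    induction n with
    | zero =>
      intro j hj h0 hb
      obtain rfl : j = 0 := by simpa using hj
      simpa [preimagePoint] using (hκz h0).trans (hhalf z₀ ⟨hz₀.1, hb⟩)
    | succ n ih =>
      intro j hj h0 hb
      have hj' : j % N ^ n < N ^ n := Nat.mod_lt _ (by positivity)
      have hw := preimagePoint_mem hN hr hz₀ n _ hj'
      have hu := preimagePoint_mem hN hr hz₀ (n + 1) _ hj
      have hi : j / N ^ n < N := by
        rw [Nat.div_lt_iff_lt_mul (by positivity), ← pow_succ']
        exact hj
      have hRu : R.eval (preimagePoint r N z₀ (n + 1) j) = preimagePoint r N z₀ n (j % N ^ n) :=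
        (hr _ hw).eval_eq hi
      have hub : preimagePoint r N z₀ (n + 1) j ∈ Set.Icc 0 b := ⟨hu.1, hb⟩
      set u := preimagePoint r N z₀ (n + 1) j with hu_def
      rcases le_or_gt (preimagePoint r N z₀ n (j % N ^ n)) b with hwb | hwb
      · have hi0 : j / N ^ n = 0 := by
          by_contra h
          exact hb.not_gt ((hr _ hw).lt_of_ne_zero hB.derivative_pos hi h)
        have hjn : j < N ^ n := by
          rcases Nat.div_eq_zero_iff.1 hi0 with h | h
          · exact absurd h (by positivity)
          · exact h
        rw [Nat.mod_eq_of_lt hjn] at hRu hwb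
        have hw0 : preimagePoint r N z₀ n j ≠ 0 := fun h => by
          have := hB.mul_le_eval u hub
          rw [hRu, h] at this
          have : 0 < u := hu.1.lt_of_ne' h0
          nlinarith [hB.one_lt]
        have hs := hB.sub_le u hub
        rw [hRu] at hs
        refine (ih j hjn hw0 hwb).trans ?_
        rw [pow_succ c, mul_assoc]
        gcongr
      · have hL := hB.eval_le_mul u hub
        rw [hRu] at hL
        have : b / (2 * L) ≤ u / 2 := by
          rw [div_le_iff₀ (mul_pos two_pos hB.L_pos)]
          linarith
        rw [mul_comm]
        exact mul_le_mul (hpow _ _ hj) (hκL.trans (this.trans (hhalf u hub))) hκ.le (by positivity)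
  refine ⟨κ, hκ, fun n j hj h0 => ?_⟩
  rcases le_or_gt (preimagePoint r N z₀ n j) b with hb | hb
  · refine (hsmall n j hj h0 hb).trans ?_
    have := mul_nonneg hB.nonneg (sq_nonneg (preimagePoint r N z₀ n j))
    gcongr
    linarith
  · rw [mul_comm]
    exact mul_le_mul (hpow n j hj) (hκb.trans hb.le) hκ.le (by positivity)

end Tree

theorem tendsto_sum_range_cpow {c : ℝ} (hc1 : 1 < c) {N : ℕ} {x : ℕ → ℕ → ℝ} {T : Set ℕ}
    (hx : ∀ n, ∀ j < N ^ n, 0 ≤ x n j)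
    (hT : ∀ n, ∀ j < N ^ n, x n j ≠ 0 → j ∈ T) {μ : ℕ → ℝ} (hμ : ∀ j ∈ T, 0 < μ j)
    (hμlim : ∀ j ∈ T, Tendsto (fun n => c ^ n * x n j) atTop (nhds (μ j))) (hN : 1 < N)
    {κ q : ℝ} (hκ : 0 < κ)
    (hle : ∀ n, ∀ j < N ^ n, x n j ≠ 0 → κ * ((j : ℝ) + 1) ^ q ≤ c ^ n * x n j)
    {s : ℂ} (hs : 0 ≤ s.re) (hqs : 1 < q * (s.re / 2)) :
    ∃ l : ℂ,
      Tendsto (fun n => ∑ j ∈ Finset.range (N ^ n),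
        if (x n j : ℂ) = 0 then 0 else ((c : ℂ) ^ n * x n j) ^ (-s / 2)) atTop (nhds l) ∧
      HasSum (fun j : T => (μ j : ℂ) ^ (-s / 2)) l := by
  classical
  have hc0 : 0 < c := by linarith
  let F : ℕ → ℕ → ℂ := fun n j => if j < N ^ n then
    (if (x n j : ℂ) = 0 then 0 else ((c : ℂ) ^ n * x n j) ^ (-s / 2)) else 0
  let G : ℕ → ℂ := T.indicator fun j => (μ j : ℂ) ^ (-s / 2)
  let B : ℕ → ℝ := fun j => κ ^ (-(s.re / 2)) * ((j : ℝ) + 1) ^ (-(q * (s.re / 2)))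
  have hB : Summable B := by
    refine Summable.mul_left _ ?_
    have h := Real.summable_nat_rpow.2 (show -(q * (s.re / 2)) < -1 by linarith)
    simpa using (summable_nat_add_iff 1).2 h
  have hre : (-s / 2).re = -(s.re / 2) := by simp; ring
  have hFB : ∀ n j, ‖F n j‖ ≤ B j := fun n j => by
    have hB0 : 0 ≤ B j := by positivity
    by_cases hj : j < N ^ n
    · by_cases h0 : x n j = 0
      · simpa [F, h0] using hB0
      · have hpos : 0 < c ^ n * x n j :=
          mul_pos (by positivity) ((hx n j hj).lt_of_ne' h0)
        have hcast : (c : ℂ) ^ n * x n j = ((c ^ n * x n j : ℝ) : ℂ) := by push_cast; rfl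
        simp only [F, if_pos hj, Complex.ofReal_eq_zero, if_neg h0]
        rw [hcast, Complex.norm_cpow_eq_rpow_re_of_pos hpos, hre]
        refine (Real.rpow_le_rpow_of_nonpos (by positivity) (hle n j hj h0)
          (by linarith)).trans_eq ?_
        rw [Real.mul_rpow hκ.le (by positivity), ← Real.rpow_mul (by positivity), mul_neg]
    · simpa [F, hj] using hB0
  have hFG : ∀ j, Tendsto (F · j) atTop (nhds (G j)) := fun j => by
    by_cases hjT : j ∈ T
    · have hlim : Tendsto (fun n => ((c ^ n * x n j : ℝ) : ℂ) ^ (-s / 2)) atTop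
          (nhds ((μ j : ℂ) ^ (-s / 2))) := by
        refine ((Complex.continuous_ofReal.tendsto _).comp (hμlim j hjT)).cpow
          tendsto_const_nhds (Or.inl ?_)
        simpa using hμ j hjT
      simp only [G, Set.indicator_of_mem hjT]
      refine hlim.congr' ?_
      filter_upwards [(hμlim j hjT).eventually_const_lt (hμ j hjT),
        (tendsto_pow_atTop_atTop_of_one_lt hN).eventually_gt_atTop j] with n hn hjn
      have h0 : x n j ≠ 0 := fun h => by simp [h] at hn
      simp [F, hjn, h0]
    · have : ∀ n, F n j = 0 := fun n => by
        by_cases hj : j < N ^ n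
        · have : x n j = 0 := by
            by_contra h
            exact hjT (hT n j hj h)
          simp [F, this]
        · simp [F, hj]
      simp only [G, Set.indicator_of_notMem hjT, this]
      exact tendsto_const_nhds
  have hG : Summable G := hB.of_norm_bounded fun j =>
    le_of_tendsto' (hFG j).norm fun n => hFB n j
  refine ⟨∑' j, G j, ?_, ?_⟩
  · refine (tendsto_tsum_of_dominated_convergence hB hFG
      (Eventually.of_forall fun n j => hFB n j)).congr fun n => ?_
    rw [tsum_eq_sum (s := Finset.range (N ^ n)) fun j hj => if_neg (by simpa using hj)]
    exact Finset.sum_congr rfl fun j hj => if_pos (Finset.mem_range.1 hj)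
  · exact hasSum_subtype_iff_indicator.2 hG.hasSum

theorem zeta_of_polynomial_dirichlet_series
    (R : Polynomial ℝ) (N : ℕ) (hN : R.natDegree = N) (hN2 : 2 ≤ N)
    (hR0 : R.eval 0 = 0) (c : ℝ) (hc : R.derivative.eval 0 = c) (hc1 : 1 < c)
    (a : ℝ) (ha : 0 < a)
    (hinv : ∀ z : ℂ, memIcc a (Polynomial.aeval z R) → memIcc a z)
    (z₀ : ℝ) (hz₀ : z₀ ∈ Set.Icc 0 a) :
    ∃ lam : ℕ → ℝ,
      Monotone lam ∧
      Filter.Tendsto lam Filter.atTop Filter.atTop ∧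
      (∀ j, 0 < lam j) ∧
      (∀ s : ℂ, 2 * Real.log N / Real.log c < s.re →
        ∃ L : ℂ,
          Filter.Tendsto (fun n => zetaPartial R c z₀ n s) Filter.atTop (nhds L) ∧
          HasSum (fun j => ((lam j : ℂ)) ^ (-s / 2)) L) := by
  have hN0 : 0 < N := by omega
  have hR : R ≠ 0 := by
    rintro rfl
    simp at hN
    omega
  have hex : ∀ w, ∃ r, w ∈ Set.Icc 0 a → IsRootList R N a w r := fun w => by
    by_cases hw : w ∈ Set.Icc 0 a
    · obtain ⟨r, hr⟩ := exists_isRootList hN hN2 hinv hw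
      exact ⟨r, fun _ => hr⟩
    · exact ⟨0, fun h => absurd h hw⟩
  choose r hr using hex
  obtain ⟨b, M, L, θ, hB⟩ := exists_repellingBounds hR0 hc hc1
  have hlogN : 0 < Real.log N := Real.log_pos (by exact_mod_cast hN2)
  have hlogc : 0 < Real.log c := Real.log_pos hc1
  obtain ⟨q, hq, hqc⟩ : ∃ q, 0 < q ∧ q * Real.log N = Real.log c :=
    ⟨Real.log c / Real.log N, by positivity, div_mul_cancel₀ _ hlogN.ne'⟩
  have hNq : (N : ℝ) ^ q = c := by
    rw [Real.rpow_def_of_pos (by positivity), mul_comm, hqc, Real.exp_log (by linarith)]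
  obtain ⟨κ, hκ, hle⟩ := exists_le_pow_mul_preimagePoint hc1 hN0 hr hB hz₀ hq.le hNq
  set x := preimagePoint r N z₀
  let T : Set ℕ := {j | ∃ n, j < N ^ n ∧ x n j ≠ 0}
  have hlim : ∀ j, ∃ μ, j ∈ T → 0 < μ ∧ Tendsto (fun n => c ^ n * x n j) atTop (nhds μ) :=
    fun j => by
      by_cases hj : j ∈ T
      · obtain ⟨n, hjn, h0⟩ := hj
        obtain ⟨μ, h⟩ := exists_pos_tendsto_preimagePoint hc1 hN2 ha hR hR0 hr hB hz₀ hjn h0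
        exact ⟨μ, fun _ => h⟩
      · exact ⟨0, fun h => absurd h hj⟩
  choose μ hμ using hlim
  have hμle : ∀ j ∈ T, κ * ((j : ℝ) + 1) ^ q ≤ μ j := fun j hj => by
    refine ge_of_tendsto (hμ j hj).2 ?_
    filter_upwards [(hμ j hj).2.eventually_const_lt (hμ j hj).1,
      (tendsto_pow_atTop_atTop_of_one_lt hN2).eventually_gt_atTop j] with n hn hjn
    exact hle n j hjn fun h => by simp [h] at hn
  have hTinf : T.Infinite := (Set.finite_singleton 0).infinite_compl.mono fun j hj =>
    preimagePoint_ne_zero hN2 hr hB hz₀ hj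
  have : Infinite T := hTinf.to_subtype
  classical
  let t : ℕ ≃o T := Nat.Subtype.orderIsoOfNat T
  have ht : Tendsto (fun k => μ (t k)) atTop atTop := by
    refine tendsto_atTop_mono (fun k => hμle _ (t k).2) (Tendsto.const_mul_atTop hκ ?_)
    refine (tendsto_rpow_atTop hq).comp (tendsto_atTop_add_const_right _ _ ?_)
    exact tendsto_natCast_atTop_atTop.comp
      (StrictMono.tendsto_atTop fun _ _ h => t.strictMono h)
  obtain ⟨e, he⟩ := exists_equiv_monotone_of_tendsto_atTop ht
  refine ⟨fun k => μ (t (e k)), he, ?_, fun k => (hμ _ (t (e k)).2).1, fun s hs => ?_⟩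
  · exact ht.comp e.injective.nat_tendsto_atTop
  · have hs' : 2 * Real.log N < s.re * Real.log c := (div_lt_iff₀ hlogc).1 hs
    have hs0 : 0 ≤ s.re := (le_of_lt (by positivity)).trans hs.le
    obtain ⟨l, hl, hsum⟩ := tendsto_sum_range_cpow hc1
      (fun n j hj => (preimagePoint_mem hN0 hr hz₀ n j hj).1)
      (fun n j hj h => (⟨n, hj, h⟩ : j ∈ T)) (fun j hj => (hμ j hj).1) (fun j hj => (hμ j hj).2)
      hN2 hκ hle hs0 (by
        rw [← hqc] at hs'
        by_contra! h
        nlinarith)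
    refine ⟨l, hl.congr fun n => ?_, ?_⟩
    · rw [zetaPartial, preimageRoots_eq hN0 hR hr hz₀, Multiset.map_map]
      rfl
    · exact (e.trans t.toEquiv).hasSum_iff (f := fun j : T => (μ j : ℂ) ^ (-s / 2)) |>.2 hsum
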